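/- Let A ∈ ℝ^{n×d}, x ∈ ℝ^d, b ∈ ℝ^n, and define u(x) = exp(Ax), α(x) = ⟨u(x), 1_n⟩, c(x) = u(x) - α(x)·b, and B(x) = diag(u(x) ∘ u(x)) - (u(x) ∘ b)·u(x)^⊤ - u(x)·(u(x) ∘ b)^⊤ + ‖b‖_2² · u(x)u(x)^⊤ + diag(c(x) ∘ u(x)) - ⟨c(x), b⟩ · diag(u(x)). Let w ∈ ℝ^n, W = diag(w), let σ_min(A) > 0 be the minimum singular value of A, let l > 0 be a scalar, and let R₀ = max{‖u(x)‖_2, ‖b‖_2, ‖c(x)‖_2, 1}. If w_i² ≥ 10·R₀⁴ + l/σ_min(A)² for all i ∈ [n], then A^⊤(B(x) + W²)A ⪰ l · I_d in the positive-semidefinite order. -/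

import Mathlib

open scoped Matrix

/-- The Euclidean (ℓ2) norm of a vector in `ℝ^n`. -/
noncomputable def norm2 {n : ℕ} (v : Fin n → ℝ) : ℝ :=
  Real.sqrt (∑ i, v i ^ 2)

/-- `u(x) = exp(Ax)` applied entrywise. -/
noncomputable def uexp {n d : ℕ} (A : Matrix (Fin n) (Fin d) ℝ) (x : Fin d → ℝ) : Fin n → ℝ :=
  fun j => Real.exp (A.mulVec x j)

/-- `α(x) = ⟨u(x), 1_n⟩`. -/
noncomputable def alph {n d : ℕ} (A : Matrix (Fin n) (Fin d) ℝ) (x : Fin d → ℝ) : ℝ :=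
  ∑ j, uexp A x j

/-- `c(x) = u(x) - α(x)·b`. -/
noncomputable def cfun {n d : ℕ} (A : Matrix (Fin n) (Fin d) ℝ) (b : Fin n → ℝ)
    (x : Fin d → ℝ) : Fin n → ℝ :=
  uexp A x - alph A x • b

/-- `B(x) = diag(u∘u) - (u∘b)uᵀ - u(u∘b)ᵀ + ‖b‖₂²·uuᵀ + diag(c∘u) - ⟨c,b⟩·diag(u)`. -/
noncomputable def Bmat {n d : ℕ} (A : Matrix (Fin n) (Fin d) ℝ) (b : Fin n → ℝ)
    (x : Fin d → ℝ) : Matrix (Fin n) (Fin n) ℝ :=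
  Matrix.diagonal (fun k => uexp A x k * uexp A x k)
    - Matrix.vecMulVec (fun k => uexp A x k * b k) (uexp A x)
    - Matrix.vecMulVec (uexp A x) (fun k => uexp A x k * b k)
    + norm2 b ^ 2 • Matrix.vecMulVec (uexp A x) (uexp A x)
    + Matrix.diagonal (fun k => cfun A b x k * uexp A x k)
    - (∑ k, cfun A b x k * b k) • Matrix.diagonal (uexp A x)

theorem norm2_nonneg {n : ℕ} (v : Fin n → ℝ) : 0 ≤ norm2 v :=
  Real.sqrt_nonneg _

theorem norm2_sq {n : ℕ} (v : Fin n → ℝ) : norm2 v ^ 2 = ∑ i, v i ^ 2 :=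
  Real.sq_sqrt (Finset.sum_nonneg fun i _ => sq_nonneg (v i))

theorem abs_apply_le_norm2 {n : ℕ} (v : Fin n → ℝ) (i : Fin n) : |v i| ≤ norm2 v := by
  refine abs_le_of_sq_le_sq ?_ (norm2_nonneg v)
  rw [norm2_sq]
  exact Finset.single_le_sum (fun j _ => sq_nonneg (v j)) (Finset.mem_univ i)

theorem abs_sum_mul_le_norm2_mul_norm2 {n : ℕ} (v w : Fin n → ℝ) :
    |∑ i, v i * w i| ≤ norm2 v * norm2 w := by
  refine abs_le_of_sq_le_sq ?_ (mul_nonneg (norm2_nonneg v) (norm2_nonneg w))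
  rw [mul_pow, norm2_sq, norm2_sq]
  exact Finset.sum_mul_sq_le_sq_mul_sq _ _ _

theorem isHermitian_Bmat {n d : ℕ} (A : Matrix (Fin n) (Fin d) ℝ) (b : Fin n → ℝ)
    (x : Fin d → ℝ) : (Bmat A b x).IsHermitian := by
  ext i j
  by_cases h : i = j
  · subst h; simp
  · simp [Bmat, Matrix.vecMulVec_apply, Matrix.diagonal_apply_ne _ h,
      Matrix.diagonal_apply_ne' _ h]
    ring

/-- The rank-one terms of `B(x)` combine with `diag(u∘u)` into a sum of squares. -/
theorem dotProduct_Bmat_mulVec {n d : ℕ} (A : Matrix (Fin n) (Fin d) ℝ) (b : Fin n → ℝ)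
    (x : Fin d → ℝ) (y : Fin n → ℝ) :
    y ⬝ᵥ Bmat A b x *ᵥ y =
      ∑ k, (uexp A x k * y k - (uexp A x ⬝ᵥ y) * b k) ^ 2
        + ∑ k, (cfun A b x k - ∑ j, cfun A b x j * b j) * uexp A x k * y k ^ 2 := by
  simp only [Bmat, Matrix.add_mulVec, Matrix.sub_mulVec, Matrix.smul_mulVec,
    Matrix.vecMulVec_mulVec, dotProduct_add, dotProduct_sub, dotProduct_smul, norm2_sq]
  set q := uexp A x ⬝ᵥ y
  set s := ∑ j, cfun A b x j * b j
  have hq' : y ⬝ᵥ uexp A x = q := dotProduct_comm _ _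
  have hp : (fun k => uexp A x k * b k) ⬝ᵥ y = y ⬝ᵥ fun k => uexp A x k * b k :=
    dotProduct_comm _ _
  rw [hq', hp]
  have hsq : ∑ k, (uexp A x k * y k - q * b k) ^ 2 =
      ∑ k, (uexp A x k * y k) ^ 2 - 2 * q * (y ⬝ᵥ fun k => uexp A x k * b k)
        + q ^ 2 * ∑ k, b k ^ 2 := by
    simp only [dotProduct, Finset.mul_sum, ← Finset.sum_sub_distrib, ← Finset.sum_add_distrib]
    exact Finset.sum_congr rfl fun k _ => by ring
  have hdiag (v : Fin n → ℝ) : y ⬝ᵥ Matrix.diagonal v *ᵥ y = ∑ k, v k * y k ^ 2 := by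
    simp only [dotProduct, Matrix.mulVec_diagonal]
    exact Finset.sum_congr rfl fun k _ => by ring
  have hcs : ∑ k, (cfun A b x k - s) * uexp A x k * y k ^ 2 =
      ∑ k, cfun A b x k * uexp A x k * y k ^ 2 - s * ∑ k, uexp A x k * y k ^ 2 := by
    simp only [Finset.mul_sum, ← Finset.sum_sub_distrib]
    exact Finset.sum_congr rfl fun k _ => by ring
  rw [hsq, hcs, hdiag, hdiag, hdiag]
  simp only [smul_eq_mul, MulOpposite.smul_eq_mul_unop, MulOpposite.unop_op, mul_pow, ← sq]
  ring

/-- If `R ≥ 1` bounds `‖u(x)‖₂`, `‖b‖₂` and `‖c(x)‖₂`, then `B(x) ⪰ -2R⁴·I_n`. -/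
theorem neg_two_mul_pow_four_le_dotProduct_Bmat_mulVec {n d : ℕ}
    (A : Matrix (Fin n) (Fin d) ℝ) (b : Fin n → ℝ) (x : Fin d → ℝ) {R : ℝ} (hR : 1 ≤ R)
    (hu : norm2 (uexp A x) ≤ R) (hb : norm2 b ≤ R) (hc : norm2 (cfun A b x) ≤ R)
    (y : Fin n → ℝ) :
    -(2 * R ^ 4) * norm2 y ^ 2 ≤ y ⬝ᵥ Bmat A b x *ᵥ y := by
  have hR0 : 0 ≤ R := zero_le_one.trans hR
  have hs : |∑ j, cfun A b x j * b j| ≤ R * R :=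
    (abs_sum_mul_le_norm2_mul_norm2 _ _).trans (mul_le_mul hc hb (norm2_nonneg _) hR0)
  have hcoeff (k : Fin n) :
      -(2 * R ^ 4) ≤ (cfun A b x k - ∑ j, cfun A b x j * b j) * uexp A x k := by
    have hck : |cfun A b x k| ≤ R := (abs_apply_le_norm2 _ k).trans hc
    have huk : |uexp A x k| ≤ R := (abs_apply_le_norm2 _ k).trans hu
    have habs : |(cfun A b x k - ∑ j, cfun A b x j * b j) * uexp A x k| ≤ (R + R * R) * R := by
      rw [abs_mul]
      exact mul_le_mul ((abs_sub _ _).trans (add_le_add hck hs)) huk (abs_nonneg _) (by positivity)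
    have h2 : R ^ 2 ≤ R ^ 4 := pow_le_pow_right₀ hR (by norm_num)
    have h3 : R ^ 3 ≤ R ^ 4 := pow_le_pow_right₀ hR (by norm_num)
    linarith [(abs_le.1 habs).1]
  rw [dotProduct_Bmat_mulVec, norm2_sq, Finset.mul_sum]
  refine le_add_of_nonneg_of_le (Finset.sum_nonneg fun k _ => sq_nonneg _)
    (Finset.sum_le_sum fun k _ => ?_)
  exact mul_le_mul_of_nonneg_right (hcoeff k) (sq_nonneg _)

/-- If `σmin > 0` is (a lower bound witnessing) the minimum singular value of `A`,
`l > 0`, `R₀ = max{‖u(x)‖₂, ‖b‖₂, ‖c(x)‖₂, 1}` and `w_i² ≥ 10·R₀⁴ + l/σmin²` for all `i`,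
then `A^⊤(B(x) + W²)A ⪰ l·I_d`. -/
theorem hessian_posdef (n d : ℕ) (A : Matrix (Fin n) (Fin d) ℝ) (b w : Fin n → ℝ)
    (x : Fin d → ℝ) (σmin l : ℝ) (hσpos : 0 < σmin)
    (hσ : ∀ v : Fin d → ℝ, σmin * norm2 v ≤ norm2 (A.mulVec v))
    (hl : 0 < l)
    (R₀ : ℝ) (hR₀ : R₀ = max (max (norm2 (uexp A x)) (norm2 b)) (max (norm2 (cfun A b x)) 1))
    (hw : ∀ i, 10 * R₀ ^ 4 + l / σmin ^ 2 ≤ w i ^ 2) :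
    (Aᵀ * (Bmat A b x + Matrix.diagonal w ^ 2) * A
      - l • (1 : Matrix (Fin d) (Fin d) ℝ)).PosSemidef := by
  have hR1 : 1 ≤ R₀ := hR₀ ▸ (le_max_right _ _).trans (le_max_right _ _)
  have hu : norm2 (uexp A x) ≤ R₀ := hR₀ ▸ (le_max_left _ _).trans (le_max_left _ _)
  have hb : norm2 b ≤ R₀ := hR₀ ▸ (le_max_right _ _).trans (le_max_left _ _)
  have hc : norm2 (cfun A b x) ≤ R₀ := hR₀ ▸ (le_max_left _ _).trans (le_max_right _ _)
  refine .of_dotProduct_mulVec_nonneg ?_ fun v => ?_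
  · have hW : (Matrix.diagonal w ^ 2).IsHermitian :=
      (Matrix.isHermitian_diagonal w).pow 2
    have hH := Matrix.isHermitian_conjTranspose_mul_mul A ((isHermitian_Bmat A b x).add hW)
    rw [Matrix.conjTranspose_eq_transpose_of_trivial] at hH
    refine hH.sub ?_
    simp [Matrix.IsHermitian]
  · set y := A *ᵥ v
    have hB := neg_two_mul_pow_four_le_dotProduct_Bmat_mulVec A b x hR1 hu hb hc y
    have hWy : (10 * R₀ ^ 4 + l / σmin ^ 2) * norm2 y ^ 2 ≤ y ⬝ᵥ Matrix.diagonal w ^ 2 *ᵥ y := by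
      rw [norm2_sq, Finset.mul_sum, Matrix.diagonal_pow]
      refine Finset.sum_le_sum fun k _ => ?_
      have := mul_le_mul_of_nonneg_right (hw k) (sq_nonneg (y k))
      rw [Matrix.mulVec_diagonal, Pi.pow_apply]
      linarith
    have hAv : l * norm2 v ^ 2 ≤ l / σmin ^ 2 * norm2 y ^ 2 := by
      have h := pow_le_pow_left₀ (mul_nonneg hσpos.le (norm2_nonneg v)) (hσ v) 2
      rw [mul_pow] at h
      rw [div_mul_eq_mul_div, le_div_iff₀ (by positivity)]
      linarith [mul_le_mul_of_nonneg_left h hl.le]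
    have hquad : star v ⬝ᵥ (Aᵀ * (Bmat A b x + Matrix.diagonal w ^ 2) * A
        - l • (1 : Matrix (Fin d) (Fin d) ℝ)) *ᵥ v =
        y ⬝ᵥ Bmat A b x *ᵥ y + y ⬝ᵥ Matrix.diagonal w ^ 2 *ᵥ y - l * norm2 v ^ 2 := by
      have hv : v ⬝ᵥ v = norm2 v ^ 2 := by simp only [norm2_sq, dotProduct, ← sq]
      rw [star_trivial, Matrix.sub_mulVec, dotProduct_sub, Matrix.smul_mulVec, Matrix.one_mulVec,
        dotProduct_smul, smul_eq_mul, hv, ← Matrix.mulVec_mulVec, ← Matrix.mulVec_mulVec,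
        Matrix.dotProduct_mulVec, Matrix.vecMul_transpose, Matrix.add_mulVec, dotProduct_add]
    rw [hquad]
    have hpos : 0 ≤ R₀ ^ 4 * norm2 y ^ 2 := by positivity
    linarith
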